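/- arXiv:1911.12874 — 3 statements merged into one kernel-verified Lean document; each statement's English description precedes it below -/
import Mathlib

section
/- For any λ ∈ (0,1) and any non-empty bounded sets K, L ⊂ ℝⁿ, the number of integer points satisfies G_n((1-λ)K + λL + (-1,1)ⁿ)^(1/n) ≥ (1-λ)·G_n(K)^(1/n) + λ·G_n(L)^(1/n), where G_n(M) = |M ∩ ℤⁿ| and (-1,1)ⁿ is the open cube, and + denotes Minkowski sum. -/
open Set
open scoped Pointwise

/-- The lattice point enumerator: number of integer points of `M ⊆ ℝⁿ`. -/
noncomputable def latticeEnum (n : ℕ) (M : Set (Fin n → ℝ)) : ℕ :=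
  (M ∩ {x : Fin n → ℝ | ∀ i, ∃ z : ℤ, x i = z}).ncard

open MeasureTheory

namespace BM
variable {n : ℕ}

def hbox (l u : Fin n → ℝ) : Set (Fin n → ℝ) := Set.pi univ (fun i => Ico (l i) (u i))

theorem mem_hbox {l u x : Fin n → ℝ} : x ∈ hbox l u ↔ ∀ i, l i ≤ x i ∧ x i < u i := by
  simp [hbox]

theorem hbox_vol (l u : Fin n → ℝ) (h : ∀ i, l i < u i) :
    volume.real (hbox l u) = ∏ i, (u i - l i) :=
  Real.volume_pi_Ico_toReal (fun i => (h i).le)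

theorem hbox_meas (l u : Fin n → ℝ) : MeasurableSet (hbox l u) :=
  MeasurableSet.univ_pi (fun _ => measurableSet_Ico)

theorem hbox_bdd (l u : Fin n → ℝ) : Bornology.IsBounded (hbox l u) :=
  (Metric.isBounded_Icc l u).subset (fun x hx =>
    ⟨fun i => (mem_hbox.1 hx i).1, fun i => (mem_hbox.1 hx i).2.le⟩)

def IsBox (Q : Set (Fin n → ℝ)) : Prop := ∃ l u : Fin n → ℝ, (∀ i, l i < u i) ∧ Q = hbox l u

theorem IsBox.nonempty {Q : Set (Fin n → ℝ)} (h : IsBox Q) : Q.Nonempty := by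
  obtain ⟨l, u, h, rfl⟩ := h
  exact ⟨l, mem_hbox.2 fun i => ⟨le_rfl, h i⟩⟩

theorem isBox_of_nonempty {l u : Fin n → ℝ} (h : (hbox l u).Nonempty) : IsBox (hbox l u) := by
  obtain ⟨x, hx⟩ := h
  exact ⟨l, u, fun i => (mem_hbox.1 hx i).1.trans_lt (mem_hbox.1 hx i).2, rfl⟩

structure IsFam (F : Finset (Set (Fin n → ℝ))) : Prop where
  box : ∀ Q ∈ F, IsBox Q
  disj : (F : Set (Set (Fin n → ℝ))).PairwiseDisjoint id

theorem IsFam.meas {F : Finset (Set (Fin n → ℝ))} (h : IsFam F) :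
    MeasurableSet (⋃₀ (F : Set (Set (Fin n → ℝ)))) := by
  refine MeasurableSet.sUnion F.finite_toSet.countable ?_
  intro Q hQ
  obtain ⟨l, u, -, rfl⟩ := h.box Q hQ
  exact hbox_meas _ _

theorem IsFam.bdd {F : Finset (Set (Fin n → ℝ))} (h : IsFam F) :
    Bornology.IsBounded (⋃₀ (F : Set (Set (Fin n → ℝ)))) := by
  refine (Bornology.isBounded_sUnion F.finite_toSet).2 ?_
  intro Q hQ
  obtain ⟨l, u, -, rfl⟩ := h.box Q hQ
  exact hbox_bdd _ _

theorem IsFam.pos {F : Finset (Set (Fin n → ℝ))} (h : IsFam F) (hF : F.Nonempty) :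
    0 < volume.real (⋃₀ (F : Set (Set (Fin n → ℝ)))) := by
  obtain ⟨Q, hQ⟩ := hF
  obtain ⟨l, u, hlu, rfl⟩ := h.box Q hQ
  have h1 : 0 < volume.real (hbox l u) := by
    rw [hbox_vol l u hlu]
    exact Finset.prod_pos (fun i _ => sub_pos.2 (hlu i))
  exact h1.trans_le (measureReal_mono (subset_sUnion_of_mem hQ) h.bdd.measure_lt_top.ne)

open Classical in
noncomputable def cut (F : Finset (Set (Fin n → ℝ))) (H : Set (Fin n → ℝ)) :
    Finset (Set (Fin n → ℝ)) := (F.image (· ∩ H)).erase ∅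

theorem sUnion_cut (F : Finset (Set (Fin n → ℝ))) (H : Set (Fin n → ℝ)) :
    ⋃₀ (cut F H : Set (Set (Fin n → ℝ))) = ⋃₀ (F : Set (Set (Fin n → ℝ))) ∩ H := by
  ext x
  simp only [cut, mem_sUnion, Finset.coe_erase, Finset.coe_image, mem_sdiff, mem_image,
    Finset.mem_coe, mem_singleton_iff, mem_inter_iff]
  constructor
  · rintro ⟨_, ⟨⟨Q, hQ, rfl⟩, -⟩, hx⟩
    exact ⟨⟨Q, hQ, hx.1⟩, hx.2⟩
  · rintro ⟨⟨Q, hQ, hx⟩, hH⟩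
    exact ⟨Q ∩ H, ⟨⟨Q, hQ, rfl⟩, nonempty_iff_ne_empty.1 ⟨x, hx, hH⟩⟩, hx, hH⟩

theorem card_cut_le (F : Finset (Set (Fin n → ℝ))) (H : Set (Fin n → ℝ)) :
    (cut F H).card ≤ F.card := by
  classical
  unfold cut
  exact (Finset.card_erase_le).trans Finset.card_image_le

theorem card_cut_lt (F : Finset (Set (Fin n → ℝ))) (H Q : Set (Fin n → ℝ)) (hQ : Q ∈ F)
    (h : Q ∩ H = ∅) : (cut F H).card < F.card := by
  classical
  unfold cut
  exact (Finset.card_erase_lt_of_mem (Finset.mem_image.2 ⟨Q, hQ, h⟩)).trans_le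
    Finset.card_image_le

theorem IsFam.cut {F : Finset (Set (Fin n → ℝ))} (h : IsFam F) (H : Set (Fin n → ℝ))
    (hH : ∀ l u : Fin n → ℝ, ∃ l' u', hbox l u ∩ H = hbox l' u') : IsFam (cut F H) := by
  classical
  constructor
  · intro Q hQ
    simp only [BM.cut, Finset.mem_erase, Finset.mem_image] at hQ
    obtain ⟨hne, P, hP, rfl⟩ := hQ
    obtain ⟨l, u, -, rfl⟩ := h.box P hP
    obtain ⟨l', u', e⟩ := hH l u
    rw [e] at hne ⊢
    exact isBox_of_nonempty (nonempty_iff_ne_empty.2 hne)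
  · intro Q hQ Q' hQ' hne
    simp only [BM.cut, Finset.mem_erase, Finset.mem_image, Finset.mem_coe] at hQ hQ'
    obtain ⟨-, P, hP, rfl⟩ := hQ
    obtain ⟨-, P', hP', rfl⟩ := hQ'
    have : P ≠ P' := by rintro rfl; exact hne rfl
    exact (h.disj hP hP' this).mono inter_subset_left inter_subset_left

theorem hbox_lt (i : Fin n) (c : ℝ) (l u : Fin n → ℝ) :
    ∃ l' u', hbox l u ∩ {x | x i < c} = hbox l' u' := by
  refine ⟨l, Function.update u i (min (u i) c), ?_⟩
  ext x
  simp only [mem_inter_iff, mem_hbox, mem_ofPred_eq]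
  constructor
  · rintro ⟨h, hc⟩ j
    by_cases hj : j = i
    · subst hj; simp [h j, hc]
    · simp [hj, h j]
  · intro h
    refine ⟨fun j => ?_, ?_⟩
    · have := h j
      by_cases hj : j = i
      · subst hj; simp at this; exact ⟨this.1, this.2.1⟩
      · simpa [hj] using this
    · have := h i
      simp at this; exact this.2.2

theorem hbox_ge (i : Fin n) (c : ℝ) (l u : Fin n → ℝ) :
    ∃ l' u', hbox l u ∩ {x | x i < c}ᶜ = hbox l' u' := by
  refine ⟨Function.update l i (max (l i) c), u, ?_⟩
  ext x
  simp only [mem_inter_iff, mem_hbox, mem_ofPred_eq, mem_compl_iff, not_lt]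
  constructor
  · rintro ⟨h, hc⟩ j
    by_cases hj : j = i
    · subst hj; simp [h j, hc]
    · simp [hj, h j]
  · intro h
    refine ⟨fun j => ?_, ?_⟩
    · have := h j
      by_cases hj : j = i
      · subst hj; simp at this; exact ⟨this.1.1, this.2⟩
      · simpa [hj] using this
    · have := h i
      simp at this; exact this.1.2

theorem half_meas (i : Fin n) (c : ℝ) : MeasurableSet {x : Fin n → ℝ | x i < c} :=
  measurableSet_lt (measurable_pi_apply i) measurable_const

theorem exists_cut (B : Set (Fin n → ℝ)) (hB : MeasurableSet B) (hb : Bornology.IsBounded B)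
    (i : Fin n) (t : ℝ) (ht0 : 0 ≤ t) (ht1 : t ≤ volume.real B) :
    ∃ d, volume.real (B ∩ {x | x i < d}) = t := by
  have hfin : volume B ≠ ⊤ := hb.measure_lt_top.ne
  have hg : Continuous (fun d : ℝ => volume.real (B ∩ {x : Fin n → ℝ | x i < d})) := by
    have : (fun d : ℝ => volume.real (B ∩ {x : Fin n → ℝ | x i < d})) =
        fun d => ∫ x in B, ({x : Fin n → ℝ | x i < d}).indicator (fun _ => (1:ℝ)) x := by
      funext d
      rw [integral_indicator (half_meas i d), setIntegral_const, smul_eq_mul, mul_one,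
        measureReal_restrict_apply (half_meas i d), inter_comm]
    rw [this, continuous_iff_continuousAt]
    intro d
    refine continuousAt_of_dominated (bound := fun _ => 1) ?_ ?_ ?_ ?_
    · exact Filter.Eventually.of_forall fun d =>
        (measurable_const.indicator (half_meas i d)).aestronglyMeasurable
    · refine Filter.Eventually.of_forall fun d => Filter.Eventually.of_forall fun x => ?_
      by_cases h : x i < d <;> simp [indicator, h]
    · exact integrableOn_const hfin
    · have h0 : ∀ᵐ x : Fin n → ℝ, x i ≠ d := by
        rw [ae_iff]
        simpa [volume_pi] using Measure.pi_hyperplane (fun _ : Fin n => (volume : Measure ℝ)) i d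
      filter_upwards [ae_restrict_of_ae h0] with x hx
      rcases lt_or_gt_of_ne hx with h | h
      · refine (continuousAt_const (y := (1:ℝ))).congr ?_
        filter_upwards [lt_mem_nhds h] with e he
        simp [indicator, he]
      · refine (continuousAt_const (y := (0:ℝ))).congr ?_
        filter_upwards [gt_mem_nhds h] with e he
        simp [indicator, he.le]
  obtain ⟨R, hR⟩ := hb.subset_closedBall 0
  have hR' : ∀ x ∈ B, |x i| ≤ R := fun x hx => by
    have := hR hx
    rw [mem_closedBall_zero_iff] at this
    exact (norm_le_pi_norm x i).trans this
  have e0 : volume.real (B ∩ {x | x i < -|R|}) = 0 := by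
    have : B ∩ {x | x i < -|R|} = ∅ := by
      ext x
      simp only [mem_inter_iff, mem_ofPred_eq, mem_empty_iff_false, iff_false, not_and, not_lt]
      intro hx
      have := (abs_le.1 (hR' x hx)).1
      have := le_abs_self R
      linarith
    simp [this]
  have e1 : B ∩ {x | x i < |R| + 1} = B := by
    refine inter_eq_left.2 fun x hx => ?_
    have := (abs_le.1 (hR' x hx)).2
    have := le_abs_self R
    simp only [mem_ofPred_eq]
    linarith
  have := intermediate_value_Icc (by have := abs_nonneg R; linarith : -|R| ≤ |R| + 1)
    hg.continuousOn
  have := this (show t ∈ _ by rw [e0, e1]; exact ⟨ht0, ht1⟩)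
  obtain ⟨d, -, hd⟩ := this
  exact ⟨d, hd⟩

theorem amgm (hn : 0 < n) (p q : Fin n → ℝ) (hp : ∀ i, 0 < p i) (hq : ∀ i, 0 < q i) :
    ((∏ i, p i) ^ ((1:ℝ)/n) + (∏ i, q i) ^ ((1:ℝ)/n)) ^ n ≤ ∏ i, (p i + q i) := by
  have hn' : (0:ℝ) < n := by exact_mod_cast hn
  have key : ∀ z : Fin n → ℝ, (∀ i, 0 < z i) →
      (∏ i, z i / (p i + q i)) ^ ((1:ℝ)/n) ≤ ∑ i, (1/(n:ℝ)) * (z i / (p i + q i)) := by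
    intro z hz
    have hz' : ∀ i, 0 ≤ z i / (p i + q i) := fun i =>
      (div_pos (hz i) (add_pos (hp i) (hq i))).le
    have := Real.geom_mean_le_arith_mean_weighted Finset.univ (fun _ : Fin n => 1/(n:ℝ))
      (fun i => z i / (p i + q i)) (fun _ _ => by positivity)
      (by simp; field_simp) (fun i _ => hz' i)
    rwa [Real.finsetProd_rpow _ _ (fun i _ => hz' i)] at this
  have hS : 0 < ∏ i, (p i + q i) := Finset.prod_pos fun i _ => add_pos (hp i) (hq i)
  have hP : 0 < ∏ i, p i := Finset.prod_pos fun i _ => hp i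
  have hQ : 0 < ∏ i, q i := Finset.prod_pos fun i _ => hq i
  have h1 := key p hp
  have h2 := key q hq
  have h3 : ∑ i, (1/(n:ℝ)) * (p i / (p i + q i)) + ∑ i, (1/(n:ℝ)) * (q i / (p i + q i)) = 1 := by
    rw [← Finset.sum_add_distrib]
    have : ∀ i, (1/(n:ℝ)) * (p i / (p i + q i)) + (1/(n:ℝ)) * (q i / (p i + q i)) = 1/n := by
      intro i
      have := (add_pos (hp i) (hq i)).ne'
      field_simp
    simp only [this]
    simp; field_simp
  rw [Finset.prod_div_distrib, Real.div_rpow (by positivity) hS.le] at h1 h2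
  have hS' : 0 < (∏ i, (p i + q i)) ^ ((1:ℝ)/n) := Real.rpow_pos_of_pos hS _
  have h4 : (∏ i, p i) ^ ((1:ℝ)/n) + (∏ i, q i) ^ ((1:ℝ)/n) ≤ (∏ i, (p i + q i)) ^ ((1:ℝ)/n) := by
    rw [← div_le_one hS', add_div]
    linarith
  calc _ ≤ ((∏ i, (p i + q i)) ^ ((1:ℝ)/n)) ^ n := by gcongr
    _ = _ := by rw [one_div, Real.rpow_inv_natCast_pow hS.le hn.ne']

theorem hbox_add (l u l' u' : Fin n → ℝ) (h : ∀ i, l i < u i) (h' : ∀ i, l' i < u' i) :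
    hbox (l + l') (u + u') ⊆ hbox l u + hbox l' u' := by
  intro x hx
  rw [mem_hbox] at hx
  let t : Fin n → ℝ := fun i => (x i - (l i + l' i)) / (u i - l i + (u' i - l' i))
  have ht : ∀ i, 0 ≤ t i ∧ t i < 1 := by
    intro i
    have a := h i; have b := h' i
    have c := hx i
    simp only [Pi.add_apply] at c
    have d : 0 < u i - l i + (u' i - l' i) := by linarith
    exact ⟨div_nonneg (by linarith) d.le, by rw [div_lt_one d]; linarith⟩
  refine mem_add.2 ⟨fun i => l i + t i * (u i - l i), ?_, fun i => l' i + t i * (u' i - l' i), ?_, ?_⟩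
  · rw [mem_hbox]; intro i
    have a := h i; have b := ht i
    constructor <;> nlinarith
  · rw [mem_hbox]; intro i
    have a := h' i; have b := ht i
    constructor <;> nlinarith
  · funext i
    have a := h i; have b := h' i
    have d : u i - l i + (u' i - l' i) ≠ 0 := by linarith
    have : t i * (u i - l i + (u' i - l' i)) = x i - (l i + l' i) := div_mul_cancel₀ _ d
    simp only [Pi.add_apply]
    linarith

theorem bm_box (hn : 0 < n) (P Q : Set (Fin n → ℝ)) (hP : IsBox P) (hQ : IsBox Q) :
    ((volume.real P) ^ ((1:ℝ)/n) + (volume.real Q) ^ ((1:ℝ)/n)) ^ n ≤ volume.real (P + Q) := by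
  obtain ⟨l, u, h, rfl⟩ := hP
  obtain ⟨l', u', h', rfl⟩ := hQ
  have h1 := measureReal_mono (μ := volume) (hbox_add l u l' u' h h')
    ((hbox_bdd l u).add (hbox_bdd l' u')).measure_lt_top.ne
  refine le_trans ?_ h1
  rw [hbox_vol _ _ h, hbox_vol _ _ h', hbox_vol (l + l') (u + u') (fun i => add_lt_add (h i) (h' i))]
  refine (amgm hn _ _ (fun i => sub_pos.2 (h i)) (fun i => sub_pos.2 (h' i))).trans_eq ?_
  refine Finset.prod_congr rfl fun i _ => ?_
  simp only [Pi.add_apply]; ring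

theorem separate (P Q : Set (Fin n → ℝ)) (hP : IsBox P) (hQ : IsBox Q) (hd : Disjoint P Q) :
    ∃ (i : Fin n) (c : ℝ), (P ∩ {x | x i < c}ᶜ = ∅ ∧ Q ∩ {x | x i < c} = ∅) ∨
      (Q ∩ {x | x i < c}ᶜ = ∅ ∧ P ∩ {x | x i < c} = ∅) := by
  obtain ⟨l, u, h, rfl⟩ := hP
  obtain ⟨l', u', h', rfl⟩ := hQ
  by_cases hi : ∃ i, u i ≤ l' i ∨ u' i ≤ l i
  · obtain ⟨i, hi | hi⟩ := hi
    · refine ⟨i, u i, Or.inl ⟨?_, ?_⟩⟩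
      · ext x
        simp only [mem_inter_iff, mem_hbox, mem_compl_iff, mem_ofPred_eq, mem_empty_iff_false,
          iff_false, not_and, not_not]
        exact fun hx => (hx i).2
      · ext x
        simp only [mem_inter_iff, mem_hbox, mem_ofPred_eq, mem_empty_iff_false,
          iff_false, not_and, not_lt]
        exact fun hx => hi.trans (hx i).1
    · refine ⟨i, u' i, Or.inr ⟨?_, ?_⟩⟩
      · ext x
        simp only [mem_inter_iff, mem_hbox, mem_compl_iff, mem_ofPred_eq, mem_empty_iff_false,
          iff_false, not_and, not_not]
        exact fun hx => (hx i).2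
      · ext x
        simp only [mem_inter_iff, mem_hbox, mem_ofPred_eq, mem_empty_iff_false,
          iff_false, not_and, not_lt]
        exact fun hx => hi.trans (hx i).1
  · push Not at hi
    exfalso
    refine Set.disjoint_left.1 hd (?_ : (fun i => max (l i) (l' i)) ∈ _) ?_
    · exact mem_hbox.2 fun i => ⟨le_max_left _ _, max_lt (h i) (hi i).1⟩
    · exact mem_hbox.2 fun i => ⟨le_max_right _ _, max_lt (hi i).2 (h' i)⟩

abbrev UU (F : Finset (Set (Fin n → ℝ))) : Set (Fin n → ℝ) := ⋃₀ (F : Set (Set (Fin n → ℝ)))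

def BMle (n : ℕ) (A B : Set (Fin n → ℝ)) : Prop :=
  ((volume.real A) ^ ((1:ℝ)/n) + (volume.real B) ^ ((1:ℝ)/n)) ^ n ≤ volume.real (A + B)

theorem BMle.symm {A B : Set (Fin n → ℝ)} (h : BMle n A B) : BMle n B A := by
  unfold BMle at *
  rwa [add_comm B A, add_comm (_ ^ _)]

theorem scale (hn : 0 < n) (t a b : ℝ) (ht : 0 ≤ t) (ha : 0 ≤ a) (hb : 0 ≤ b) :
    ((t * a) ^ ((1:ℝ)/n) + (t * b) ^ ((1:ℝ)/n)) ^ n =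
      t * (a ^ ((1:ℝ)/n) + b ^ ((1:ℝ)/n)) ^ n := by
  rw [Real.mul_rpow ht ha, Real.mul_rpow ht hb, ← mul_add, mul_pow, one_div,
    Real.rpow_inv_natCast_pow ht hn.ne']

theorem nonempty_of_pos {F : Finset (Set (Fin n → ℝ))} (h : 0 < volume.real (UU F)) :
    F.Nonempty := by
  rw [Finset.nonempty_iff_ne_empty]
  rintro rfl
  simp [UU] at h

theorem step (hn : 0 < n) (F G : Finset (Set (Fin n → ℝ))) (hF : IsFam F) (hG : IsFam G)
    (hG0 : G.Nonempty) (hF1 : 1 < F.card)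
    (ih : ∀ F' G' : Finset (Set (Fin n → ℝ)), IsFam F' → IsFam G' → F'.Nonempty → G'.Nonempty →
      F'.card + G'.card < F.card + G.card → BMle n (UU F') (UU G')) :
    BMle n (UU F) (UU G) := by
  obtain ⟨P, hP, Q, hQ, hPQ⟩ := Finset.one_lt_card.1 hF1
  have hF0 : F.Nonempty := ⟨P, hP⟩
  obtain ⟨i, c, hc⟩ : ∃ (i : Fin n) (c : ℝ), ∃ P ∈ F, ∃ Q ∈ F,
      P ∩ {x | x i < c}ᶜ = ∅ ∧ Q ∩ {x | x i < c} = ∅ := by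
    obtain ⟨i, c, h | h⟩ := separate P Q (hF.box P hP) (hF.box Q hQ) (hF.disj hP hQ hPQ)
    · exact ⟨i, c, P, hP, Q, hQ, h⟩
    · exact ⟨i, c, Q, hQ, P, hP, h⟩
  clear! P Q
  obtain ⟨P, hP, Q, hQ, hPc, hQc⟩ := hc
  set H : Set (Fin n → ℝ) := {x | x i < c} with hH
  have hF1 := hF.cut H (hbox_lt i c)
  have hF2 := hF.cut Hᶜ (hbox_ge i c)
  have nF1 : (cut F H).Nonempty := by
    by_contra hne
    rw [Finset.not_nonempty_iff_eq_empty] at hne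
    have := sUnion_cut F H
    rw [hne] at this
    obtain ⟨x, hx⟩ := (hF.box P hP).nonempty
    have hxH : x ∈ H := by
      by_contra hxH
      have : x ∈ P ∩ Hᶜ := ⟨hx, hxH⟩
      rw [hPc] at this; exact this
    have hh : x ∈ UU F ∩ H := ⟨⟨P, hP, hx⟩, hxH⟩
    rw [← this] at hh
    simp at hh
  have nF2 : (cut F Hᶜ).Nonempty := by
    by_contra hne
    rw [Finset.not_nonempty_iff_eq_empty] at hne
    have := sUnion_cut F Hᶜ
    rw [hne] at this
    obtain ⟨x, hx⟩ := (hF.box Q hQ).nonempty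
    have hxH : x ∈ Hᶜ := by
      intro hxH
      have : x ∈ Q ∩ H := ⟨hx, hxH⟩
      rw [hQc] at this; exact this
    have hh : x ∈ UU F ∩ Hᶜ := ⟨⟨Q, hQ, hx⟩, hxH⟩
    rw [← this] at hh
    simp at hh
  have pF1 := hF1.pos nF1
  have pF2 := hF2.pos nF2
  have c1 : (cut F H).card < F.card := card_cut_lt F H Q hQ hQc
  have c2 : (cut F Hᶜ).card < F.card := card_cut_lt F Hᶜ P hP hPc
  have pG : 0 < volume.real (UU G) := hG.pos hG0
  have pF : 0 < volume.real (UU F) := hF.pos hF0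
  have sF : volume.real (UU F ∩ H) + volume.real (UU F ∩ Hᶜ) = volume.real (UU F) := by
    rw [← sdiff_eq]
    exact measureReal_inter_add_sdiff (half_meas i c) hF.bdd.measure_lt_top.ne
  rw [sUnion_cut] at pF1 pF2
  change 0 < volume.real (UU F ∩ H) at pF1
  change 0 < volume.real (UU F ∩ Hᶜ) at pF2
  obtain ⟨t, ht⟩ : ∃ t, t = volume.real (UU F ∩ H) / volume.real (UU F) := ⟨_, rfl⟩
  have ht0 : 0 < t := by rw [ht]; positivity
  have ht1 : t < 1 := by rw [ht, div_lt_one pF]; linarith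
  have tF1 : volume.real (UU F ∩ H) = t * volume.real (UU F) := by rw [ht]; field_simp
  have tF2 : volume.real (UU F ∩ Hᶜ) = (1 - t) * volume.real (UU F) := by linarith
  obtain ⟨d, hd⟩ := exists_cut (UU G) hG.meas hG.bdd i (t * volume.real (UU G)) (by positivity)
    (by nlinarith)
  set D : Set (Fin n → ℝ) := {x | x i < d} with hD
  have sG : volume.real (UU G ∩ D) + volume.real (UU G ∩ Dᶜ) = volume.real (UU G) := by
    rw [← sdiff_eq]
    exact measureReal_inter_add_sdiff (half_meas i d) hG.bdd.measure_lt_top.ne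
  have hd2 : volume.real (UU G ∩ Dᶜ) = (1 - t) * volume.real (UU G) := by linarith
  have hG1 := hG.cut D (hbox_lt i d)
  have hG2 := hG.cut Dᶜ (hbox_ge i d)
  have nG1 : (cut G D).Nonempty := nonempty_of_pos (by
    rw [UU, sUnion_cut]; change 0 < volume.real (UU G ∩ D); rw [hd]; positivity)
  have nG2 : (cut G Dᶜ).Nonempty := nonempty_of_pos (by
    rw [UU, sUnion_cut]; change 0 < volume.real (UU G ∩ Dᶜ); rw [hd2]
    exact mul_pos (by linarith) pG)
  have i1 := ih _ _ hF1 hG1 nF1 nG1 (by have := card_cut_le G D; omega)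
  have i2 := ih _ _ hF2 hG2 nF2 nG2 (by have := card_cut_le G Dᶜ; omega)
  unfold BMle at i1 i2 ⊢
  simp only [UU, sUnion_cut] at i1 i2
  change (volume.real (UU F ∩ H) ^ _ + volume.real (UU G ∩ D) ^ _) ^ n ≤
    volume.real (UU F ∩ H + UU G ∩ D) at i1
  change (volume.real (UU F ∩ Hᶜ) ^ _ + volume.real (UU G ∩ Dᶜ) ^ _) ^ n ≤
    volume.real (UU F ∩ Hᶜ + UU G ∩ Dᶜ) at i2
  rw [tF1, hd, scale hn _ _ _ ht0.le pF.le pG.le] at i1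
  rw [tF2, hd2, scale hn _ _ _ (by linarith) pF.le pG.le] at i2
  have hfin : volume (UU F + UU G) ≠ ⊤ := (hF.bdd.add hG.bdd).measure_lt_top.ne
  have hs := measureReal_inter_add_sdiff (μ := volume) (s := UU F + UU G) (half_meas i (c + d)) hfin
  have m1 : volume.real (UU F ∩ H + UU G ∩ D) ≤
      volume.real ((UU F + UU G) ∩ {x | x i < c + d}) := by
    refine measureReal_mono ?_ (measure_ne_top_of_subset inter_subset_left hfin)
    rintro _ ⟨x, ⟨hx, hxH⟩, y, ⟨hy, hyD⟩, rfl⟩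
    refine ⟨⟨x, hx, y, hy, rfl⟩, ?_⟩
    simp only [hH, hD, mem_ofPred_eq, Pi.add_apply] at hxH hyD ⊢
    exact add_lt_add hxH hyD
  have m2 : volume.real (UU F ∩ Hᶜ + UU G ∩ Dᶜ) ≤
      volume.real ((UU F + UU G) \ {x | x i < c + d}) := by
    refine measureReal_mono ?_ (measure_ne_top_of_subset sdiff_subset hfin)
    rintro _ ⟨x, ⟨hx, hxH⟩, y, ⟨hy, hyD⟩, rfl⟩
    refine ⟨⟨x, hx, y, hy, rfl⟩, ?_⟩
    simp only [hH, hD, mem_compl_iff, mem_ofPred_eq, not_lt, Pi.add_apply] at hxH hyD ⊢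
    exact add_le_add hxH hyD
  linarith

theorem bm (hn : 0 < n) (N : ℕ) : ∀ (F G : Finset (Set (Fin n → ℝ))), IsFam F → IsFam G →
    F.Nonempty → G.Nonempty → F.card + G.card = N → BMle n (UU F) (UU G) := by
  induction N using Nat.strong_induction_on with
  | _ N ih =>
    intro F G hF hG hF0 hG0 hN
    by_cases h1 : 1 < F.card
    · exact step hn F G hF hG hG0 h1 fun F' G' a b c d e => ih _ (by omega) F' G' a b c d rfl
    by_cases h2 : 1 < G.card
    · exact (step hn G F hG hF hF0 h2 fun F' G' a b c d e =>
        ih _ (by omega) F' G' a b c d rfl).symm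
    have := hF0.card_pos
    have := hG0.card_pos
    obtain ⟨P, rfl⟩ := Finset.card_eq_one.1 (by omega : F.card = 1)
    obtain ⟨Q, rfl⟩ := Finset.card_eq_one.1 (by omega : G.card = 1)
    simp only [BMle, UU, Finset.coe_singleton, sUnion_singleton]
    exact bm_box hn P Q (hF.box P (by simp)) (hG.box Q (by simp))

def cube (m : ℝ) (a : Fin n → ℝ) : Set (Fin n → ℝ) :=
  hbox (fun i => m * a i) (fun i => m * a i + m)

def IsInt (x : Fin n → ℝ) : Prop := ∀ i, ∃ z : ℤ, x i = z

theorem cube_disj (m : ℝ) (hm : 0 < m) (a b : Fin n → ℝ) (ha : IsInt a) (hb : IsInt b)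
    (hab : a ≠ b) : Disjoint (cube m a) (cube m b) := by
  rw [Set.disjoint_left]
  intro x hx hy
  apply hab
  funext i
  have h1 := mem_hbox.1 hx i
  have h2 := mem_hbox.1 hy i
  obtain ⟨p, hp⟩ := ha i
  obtain ⟨q, hq⟩ := hb i
  simp only [hp, hq] at h1 h2 ⊢
  have e1 : (p : ℝ) < q + 1 := by
    by_contra hc
    push Not at hc
    nlinarith
  have e2 : (q : ℝ) < p + 1 := by
    by_contra hc
    push Not at hc
    nlinarith
  have e1' : p < q + 1 := by exact_mod_cast e1
  have e2' : q < p + 1 := by exact_mod_cast e2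
  have : p = q := by omega
  rw [this]

theorem cube_box (m : ℝ) (hm : 0 < m) (a : Fin n → ℝ) : IsBox (cube m a) :=
  ⟨_, _, fun i => by linarith, rfl⟩

open Classical in
noncomputable def fam (m : ℝ) (S : Finset (Fin n → ℝ)) : Finset (Set (Fin n → ℝ)) :=
  S.image (cube m)

theorem fam_isFam (m : ℝ) (hm : 0 < m) (S : Finset (Fin n → ℝ)) (hS : ∀ a ∈ S, IsInt a) :
    IsFam (fam m S) := by
  classical
  constructor
  · intro Q hQ
    obtain ⟨a, -, rfl⟩ := Finset.mem_image.1 hQ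
    exact cube_box m hm a
  · intro Q hQ Q' hQ' hne
    obtain ⟨a, ha, rfl⟩ := Finset.mem_image.1 (Finset.mem_coe.1 hQ)
    obtain ⟨b, hb, rfl⟩ := Finset.mem_image.1 (Finset.mem_coe.1 hQ')
    exact cube_disj m hm a b (hS a ha) (hS b hb) (by rintro rfl; exact hne rfl)

theorem fam_UU (m : ℝ) (S : Finset (Fin n → ℝ)) : UU (fam m S) = ⋃ a ∈ S, cube m a := by
  classical
  simp [UU, fam, sUnion_image]

theorem fam_vol (m : ℝ) (hm : 0 < m) (S : Finset (Fin n → ℝ)) (hS : ∀ a ∈ S, IsInt a) :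
    volume.real (UU (fam m S)) = m ^ n * S.card := by
  rw [fam_UU, measureReal_biUnion_finset (f := cube m) (μ := volume) (s := S)
    (h := fun a _ => (hbox_bdd (fun i => m * a i) (fun i => m * a i + m)).measure_lt_top.ne)]
  · have : ∀ a ∈ S, volume.real (cube m a) = m ^ n := by
      intro a _
      rw [cube, hbox_vol _ _ (fun i => by linarith)]
      simp
    rw [Finset.sum_congr rfl this]
    simp [mul_comm]
  · intro a ha b hb hab
    exact cube_disj m hm a b (hS a ha) (hS b hb) hab
  · exact fun a _ => hbox_meas _ _

theorem finite_lattice (M : Set (Fin n → ℝ)) (hM : Bornology.IsBounded M) :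
    (M ∩ {x : Fin n → ℝ | ∀ i, ∃ z : ℤ, x i = z}).Finite := by
  obtain ⟨R, hR⟩ := hM.subset_closedBall 0
  refine ((Set.finite_Icc (fun _ : Fin n => -⌈R⌉) (fun _ : Fin n => ⌈R⌉)).image
    (fun (z : Fin n → ℤ) (i : Fin n) => (z i : ℝ))).subset ?_
  rintro x ⟨hx, hz⟩
  choose z hz using hz
  have h1 : ∀ i, |x i| ≤ R := fun i => by
    have := hR hx
    rw [mem_closedBall_zero_iff] at this
    exact (norm_le_pi_norm x i).trans this
  refine ⟨z, ⟨fun i => ?_, fun i => ?_⟩, funext fun i => (hz i).symm⟩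
  · have h2 := (abs_le.1 (h1 i)).1
    rw [hz i] at h2
    have h3 := Int.le_ceil R
    have : (-(⌈R⌉ : ℤ) : ℝ) ≤ z i := by linarith
    exact_mod_cast this
  · have h2 := (abs_le.1 (h1 i)).2
    rw [hz i] at h2
    have h3 := Int.le_ceil R
    have : (z i : ℝ) ≤ (⌈R⌉ : ℤ) := by linarith
    exact_mod_cast this

abbrev ocube (n : ℕ) : Set (Fin n → ℝ) := {x : Fin n → ℝ | ∀ i, x i ∈ Set.Ioo (-1 : ℝ) 1}

theorem ocube_bdd : Bornology.IsBounded (ocube n) := by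
  refine (Metric.isBounded_Icc (fun _ : Fin n => (-1:ℝ)) (fun _ => 1)).subset ?_
  intro x hx
  exact ⟨fun i => (hx i).1.le, fun i => (hx i).2.le⟩

/-- Any set whose points are within `[0,1)ⁿ` of `T` has volume at most the number of lattice points
of `T + (-1,1)ⁿ`. -/
theorem vol_le (T M : Set (Fin n → ℝ)) (hT : Bornology.IsBounded T)
    (h : ∀ x ∈ M, ∃ p ∈ T, ∀ i, p i ≤ x i ∧ x i < p i + 1) :
    volume.real M ≤ latticeEnum n (T + ocube n) := by
  have hfin := finite_lattice (T + ocube n) (hT.add ocube_bdd)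
  have hS : ∀ a ∈ hfin.toFinset, IsInt a := fun a ha => (hfin.mem_toFinset.1 ha).2
  have hv := fam_vol 1 one_pos hfin.toFinset hS
  rw [one_pow, one_mul] at hv
  unfold latticeEnum
  rw [Set.ncard_eq_toFinset_card _ hfin, ← hv]
  refine measureReal_mono ?_ (fam_isFam 1 one_pos _ hS).bdd.measure_lt_top.ne
  intro x hx
  obtain ⟨p, hp, hpx⟩ := h x hx
  rw [fam_UU]
  refine mem_iUnion₂.2 ⟨fun i => (⌊x i⌋ : ℝ), ?_, ?_⟩
  · rw [hfin.mem_toFinset]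
    refine ⟨mem_add.2 ⟨p, hp, fun i => ⌊x i⌋ - p i, ?_, ?_⟩, fun i => ⟨_, rfl⟩⟩
    · intro i
      have h1 := Int.floor_le (x i)
      have h2 := Int.lt_floor_add_one (x i)
      have h3 := hpx i
      exact ⟨by linarith, by linarith⟩
    · funext i
      simp
  · refine mem_hbox.2 fun i => ?_
    simp only [one_mul]
    exact ⟨Int.floor_le _, Int.lt_floor_add_one _⟩

theorem smul_bdd {K : Set (Fin n → ℝ)} (hK : Bornology.IsBounded K) (p : ℝ) :
    Bornology.IsBounded (p • K) := hK.smul₀ p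

theorem root (hn : 0 < n) (m c : ℝ) (hm : 0 ≤ m) (hc : 0 ≤ c) :
    (m ^ n * c) ^ ((1:ℝ)/n) = m * c ^ ((1:ℝ)/n) := by
  rw [Real.mul_rpow (by positivity) hc, one_div, Real.pow_rpow_inv_natCast hm hn.ne']

/-- Case in which one of the sets has no lattice point. -/
theorem oneside (hn : 0 < n) (p q : ℝ) (hp : 0 < p) (hp1 : p ≤ 1)
    (K L : Set (Fin n → ℝ)) (hL : L.Nonempty)
    (hKb : Bornology.IsBounded K) (hLb : Bornology.IsBounded L) :
    p * (latticeEnum n K : ℝ) ^ ((1 : ℝ) / n) ≤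
      (latticeEnum n (p • K + q • L + ocube n) : ℝ) ^ ((1 : ℝ) / n) := by
  obtain ⟨y, hy⟩ := hL
  have hfin := finite_lattice K hKb
  have hS : ∀ a ∈ hfin.toFinset, IsInt a := fun a ha => (hfin.mem_toFinset.1 ha).2
  have hv := fam_vol p hp hfin.toFinset hS
  rw [← Set.ncard_eq_toFinset_card _ hfin] at hv
  change _ = p ^ n * (latticeEnum n K : ℝ) at hv
  rw [← root hn p _ hp.le (Nat.cast_nonneg _), ← hv]
  refine Real.rpow_le_rpow measureReal_nonneg ?_ (by positivity)
  have ht : volume.real ((fun x => q • y + x) '' UU (fam p hfin.toFinset)) =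
      volume.real (UU (fam p hfin.toFinset)) := by
    rw [measureReal_def, measureReal_def, image_add_left, measure_preimage_add]
  rw [← ht]
  refine vol_le _ _ ((smul_bdd hKb p).add (smul_bdd hLb q)) ?_
  rintro _ ⟨x, hx, rfl⟩
  rw [fam_UU] at hx
  obtain ⟨a, ha, hxa⟩ := mem_iUnion₂.1 hx
  have haK := (hfin.mem_toFinset.1 ha).1
  refine ⟨p • a + q • y, add_mem_add (smul_mem_smul_set haK) (smul_mem_smul_set hy), fun i => ?_⟩
  have := mem_hbox.1 hxa i
  simp only [Pi.add_apply, Pi.smul_apply, smul_eq_mul]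
  constructor <;> linarith

theorem latticeEnum_zero (n : ℕ) (hn : 0 < n) (K : Set (Fin n → ℝ))
    (h : ¬ (K ∩ {x : Fin n → ℝ | ∀ i, ∃ z : ℤ, x i = z}).Nonempty) :
    (latticeEnum n K : ℝ) ^ ((1 : ℝ) / n) = 0 := by
  rw [latticeEnum, not_nonempty_iff_eq_empty.1 h, ncard_empty, Nat.cast_zero]
  exact Real.zero_rpow (by positivity)

end BM

open BM in
theorem stmt0 (n : ℕ) (hn : 0 < n) (lam : ℝ) (hlam : lam ∈ Set.Ioo (0 : ℝ) 1)
    (K L : Set (Fin n → ℝ)) (hK : K.Nonempty) (hL : L.Nonempty)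
    (hKb : Bornology.IsBounded K) (hLb : Bornology.IsBounded L) :
    (latticeEnum n ((1 - lam) • K + lam • L +
        {x : Fin n → ℝ | ∀ i, x i ∈ Set.Ioo (-1 : ℝ) 1}) : ℝ) ^ ((1 : ℝ) / n) ≥
      (1 - lam) * (latticeEnum n K : ℝ) ^ ((1 : ℝ) / n) +
        lam * (latticeEnum n L : ℝ) ^ ((1 : ℝ) / n) := by
  obtain ⟨h0, h1⟩ := hlam
  have h1' : 0 < 1 - lam := by linarith
  by_cases nK : (K ∩ {x : Fin n → ℝ | ∀ i, ∃ z : ℤ, x i = z}).Nonempty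
  swap
  · rw [latticeEnum_zero n hn K nK, mul_zero, zero_add, add_comm ((1 - lam) • K)]
    exact oneside hn lam (1 - lam) h0 h1.le L K hK hLb hKb
  by_cases nL : (L ∩ {x : Fin n → ℝ | ∀ i, ∃ z : ℤ, x i = z}).Nonempty
  swap
  · rw [latticeEnum_zero n hn L nL, mul_zero, add_zero]
    exact oneside hn (1 - lam) lam h1' (by linarith) K L hL hKb hLb
  have fK := finite_lattice K hKb
  have fL := finite_lattice L hLb
  have iK : ∀ a ∈ fK.toFinset, IsInt a := fun a ha => (fK.mem_toFinset.1 ha).2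
  have iL : ∀ a ∈ fL.toFinset, IsInt a := fun a ha => (fL.mem_toFinset.1 ha).2
  have vK := fam_vol (1 - lam) h1' fK.toFinset iK
  have vL := fam_vol lam h0 fL.toFinset iL
  rw [← Set.ncard_eq_toFinset_card _ fK] at vK
  rw [← Set.ncard_eq_toFinset_card _ fL] at vL
  change _ = _ * (latticeEnum n K : ℝ) at vK
  change _ = _ * (latticeEnum n L : ℝ) at vL
  have neK : (fam (1 - lam) fK.toFinset).Nonempty := by
    classical
    exact (fK.toFinset_nonempty.2 nK).image _
  have neL : (fam lam fL.toFinset).Nonempty := by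
    classical
    exact (fL.toFinset_nonempty.2 nL).image _
  have key := bm hn _ _ _ (fam_isFam _ h1' _ iK) (fam_isFam _ h0 _ iL) neK neL rfl
  unfold BMle at key
  rw [vK, vL, root hn _ _ h1'.le (Nat.cast_nonneg _), root hn _ _ h0.le (Nat.cast_nonneg _)] at key
  have hv := vol_le ((1 - lam) • K + lam • L)
    (UU (fam (1 - lam) fK.toFinset) + UU (fam lam fL.toFinset))
    ((smul_bdd hKb _).add (smul_bdd hLb _)) (by
      rintro _ ⟨x, hx, y, hy, rfl⟩
      rw [fam_UU] at hx hy
      obtain ⟨a, ha, hxa⟩ := mem_iUnion₂.1 hx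
      obtain ⟨b, hb, hyb⟩ := mem_iUnion₂.1 hy
      refine ⟨(1 - lam) • a + lam • b, add_mem_add
        (smul_mem_smul_set (fK.mem_toFinset.1 ha).1)
        (smul_mem_smul_set (fL.mem_toFinset.1 hb).1), fun i => ?_⟩
      have e1 := mem_hbox.1 hxa i
      have e2 := mem_hbox.1 hyb i
      simp only [Pi.add_apply, Pi.smul_apply, smul_eq_mul]
      constructor <;> linarith)
  have key2 := key.trans hv
  have hnn : 0 ≤ (1 - lam) * (latticeEnum n K : ℝ) ^ ((1 : ℝ) / n) +
        lam * (latticeEnum n L : ℝ) ^ ((1 : ℝ) / n) := by positivity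
  have := Real.rpow_le_rpow (by positivity) key2 (by positivity : (0:ℝ) ≤ 1 / n)
  rw [one_div, Real.pow_rpow_inv_natCast (by rw [← one_div]; exact hnn) hn.ne', ← one_div] at this
  exact this
end

section
/- Let K, L ⊂ ℝⁿ be bounded sets with G_n(K)·G_n(L) > 0, and let α = m/q, β = p/q with m, p, q positive integers and α + β ≤ 1. Then G_n(αK + βL + [−(q−1)/q, (q−1)/q]ⁿ)^{1/n} ≥ αG_n(K)^{1/n} + βG_n(L)^{1/n}. -/
open Set
open scoped Pointwise

/-- Slice of a finite set of lattice points at height `t`. -/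
noncomputable def bmSlice {n : ℕ} (A : Finset (Fin (n+1) → ℤ)) (t : ℤ) : Finset (Fin n → ℤ) :=
  (A.filter (fun x => x 0 = t)).image Fin.tail

theorem mem_bmSlice {n : ℕ} (A : Finset (Fin (n+1) → ℤ)) (t : ℤ) (x : Fin n → ℤ) :
    x ∈ bmSlice A t ↔ (Fin.cons t x : Fin (n+1) → ℤ) ∈ A := by
  unfold bmSlice
  simp only [Finset.mem_image, Finset.mem_filter]
  constructor
  · rintro ⟨y, ⟨hy, h0⟩, rfl⟩
    rw [← h0, Fin.cons_self_tail]
    exact hy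
  · intro h
    exact ⟨_, ⟨h, by simp⟩, by simp⟩

theorem card_eq_sum_bmSlice {n : ℕ} (A : Finset (Fin (n+1) → ℤ)) :
    A.card = ∑ t ∈ A.image (fun x => x 0), (bmSlice A t).card := by
  rw [Finset.card_eq_sum_card_image (fun x : Fin (n+1) → ℤ => x 0) A]
  refine Finset.sum_congr rfl fun t _ => ?_
  unfold bmSlice
  rw [Finset.card_image_of_injOn]
  intro x hx y hy hxy
  simp only [Finset.mem_coe, Finset.mem_filter] at hx hy
  rw [← Fin.cons_self_tail x, ← Fin.cons_self_tail y, hx.2, hy.2]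
  rw [hxy]

theorem bmSlice_nonempty {n : ℕ} (A : Finset (Fin (n+1) → ℤ)) (t : ℤ)
    (ht : t ∈ A.image (fun x => x 0)) : (bmSlice A t).Nonempty := by
  obtain ⟨x, hx, rfl⟩ := Finset.mem_image.1 ht
  exact ⟨Fin.tail x, (mem_bmSlice _ _ _).2 (by rwa [Fin.cons_self_tail])⟩

theorem bm_one_dim (X Y Z : Finset ℤ) (hX : X.Nonempty) (hY : Y.Nonempty)
    (h : ∀ s ∈ X, ∀ t ∈ Y, ∀ e : ℤ, e = 0 ∨ e = 1 → s + t + e ∈ Z) :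
    X.card + Y.card ≤ Z.card := by
  have h1 := cauchy_davenport_add_of_linearOrder_isCancelAdd hX hY
  have h2 := cauchy_davenport_add_of_linearOrder_isCancelAdd (hX.add hY)
    (t := ({0, 1} : Finset ℤ)) (by simp)
  have h3 : (X + Y) + ({0, 1} : Finset ℤ) ⊆ Z := by
    intro z hz
    obtain ⟨w, hw, e, he, rfl⟩ := Finset.mem_add.1 hz
    obtain ⟨s, hs, t, ht, rfl⟩ := Finset.mem_add.1 hw
    exact h s hs t ht e (by simpa using he)
  have h4 := Finset.card_le_card h3
  have h5 : ({0, 1} : Finset ℤ).card = 2 := by simp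
  have := hX.card_pos
  omega

open MeasureTheory in
theorem bm_layer_cake (T : Finset ℤ) (x : ℤ → ℝ) (hx : ∀ t ∈ T, 0 ≤ x t) :
    IntegrableOn (fun l : ℝ => ((T.filter (fun t => l ≤ x t)).card : ℝ)) (Set.Ioc 0 1) ∧
    ∫ l in Set.Ioc (0:ℝ) 1, ((T.filter (fun t => l ≤ x t)).card : ℝ) = ∑ t ∈ T, min (x t) 1 := by
  have e : (fun l : ℝ => ((T.filter (fun t => l ≤ x t)).card : ℝ)) =
      fun l => ∑ t ∈ T, (Set.Iic (x t)).indicator (fun _ => (1:ℝ)) l := by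
    funext l
    rw [Finset.card_filter]
    push_cast
    refine Finset.sum_congr rfl fun t _ => ?_
    simp [Set.indicator_apply]
  have hi : ∀ t ∈ T, IntegrableOn ((Set.Iic (x t)).indicator (fun _ => (1:ℝ))) (Set.Ioc 0 1) := by
    intro t _
    exact (integrable_const (1:ℝ)).indicator measurableSet_Iic
  rw [e]
  refine ⟨integrable_finsetSum _ hi, ?_⟩
  rw [integral_finsetSum _ hi]
  refine Finset.sum_congr rfl fun t ht => ?_
  rw [integral_indicator measurableSet_Iic, Measure.restrict_restrict measurableSet_Iic,
    Set.inter_comm, Set.Ioc_inter_Iic]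
  have := hx t ht
  simp [min_comm, this]

theorem bm_sum_le (S T U : Finset ℤ) (x y z : ℤ → ℝ)
    (hx : ∀ t ∈ S, 0 ≤ x t) (hy : ∀ t ∈ T, 0 ≤ y t) (hz : ∀ t ∈ U, 0 ≤ z t)
    (hx1 : ∀ t ∈ S, x t ≤ 1) (hy1 : ∀ t ∈ T, y t ≤ 1)
    (h : ∀ l : ℝ, 0 < l → l ≤ 1 → (S.filter (fun t => l ≤ x t)).card +
      (T.filter (fun t => l ≤ y t)).card ≤ (U.filter (fun t => l ≤ z t)).card) :
    ∑ t ∈ S, x t + ∑ t ∈ T, y t ≤ ∑ t ∈ U, z t := by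
  obtain ⟨ix, ex⟩ := bm_layer_cake S x hx
  obtain ⟨iy, ey⟩ := bm_layer_cake T y hy
  obtain ⟨iz, ez⟩ := bm_layer_cake U z hz
  have key := MeasureTheory.setIntegral_mono_on (ix.add iy) iz measurableSet_Ioc
    (fun l hl => by
      have := h l hl.1 hl.2
      simp only [Pi.add_apply]
      exact_mod_cast this)
  simp only [Pi.add_apply] at key
  rw [MeasureTheory.integral_add ix iy, ex, ey, ez] at key
  calc _ = ∑ t ∈ S, min (x t) 1 + ∑ t ∈ T, min (y t) 1 := by
        congr 1
        · exact Finset.sum_congr rfl fun t ht => (min_eq_left (hx1 t ht)).symm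
        · exact Finset.sum_congr rfl fun t ht => (min_eq_left (hy1 t ht)).symm
    _ ≤ _ := key
    _ ≤ _ := Finset.sum_le_sum fun t _ => min_le_left _ _

theorem bm_holder (n : ℕ) (a b u v : ℝ) (ha : 0 ≤ a) (hb : 0 ≤ b) (hu : 0 < u) (hv : 0 < v) :
    (a + b) ^ (n+1) ≤ (u + v) ^ n * (a ^ (n+1) / u ^ n + b ^ (n+1) / v ^ n) := by
  have hau : a / u ∈ Set.Ici (0:ℝ) := div_nonneg ha hu.le
  have hbv : b / v ∈ Set.Ici (0:ℝ) := div_nonneg hb hv.le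
  have h1 : 0 ≤ u / (u+v) := by positivity
  have h2 : 0 ≤ v / (u+v) := by positivity
  have h3 : u / (u+v) + v / (u+v) = 1 := by field_simp
  have h := (convexOn_pow (𝕜 := ℝ) (n+1)).2 hau hbv h1 h2 h3
  simp only [smul_eq_mul] at h
  have e1 : u / (u+v) * (a/u) + v/(u+v) * (b/v) = (a+b)/(u+v) := by field_simp
  rw [e1, div_pow, div_le_iff₀ (by positivity)] at h
  refine h.trans (le_of_eq ?_)
  rw [div_pow, div_pow, pow_succ u, pow_succ v, pow_succ (u + v)]
  field_simp

theorem bm_root (n : ℕ) (F : ℝ) (hF : 0 < F) (h0 : n = 0 → F = 1) : ∃ u : ℝ, 0 < u ∧ u ^ n = F := by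
  rcases Nat.eq_zero_or_pos n with rfl | hn
  · exact ⟨1, one_pos, by simp [h0 rfl]⟩
  · exact ⟨F ^ ((n:ℝ)⁻¹), by positivity, Real.rpow_inv_natCast_pow hF.le hn.ne'⟩

theorem bm_max {n : ℕ} (A : Finset (Fin (n+1) → ℤ)) (hA : A.Nonempty) :
    ∃ u : ℝ, 0 < u ∧ (∀ t ∈ A.image (fun x => x 0), ((bmSlice A t).card : ℝ) ≤ u ^ n) ∧
      ∃ t ∈ A.image (fun x => x 0), ((bmSlice A t).card : ℝ) = u ^ n := by
  obtain ⟨t, ht, hmax⟩ := Finset.exists_max_image (A.image (fun x => x 0))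
    (fun t => (bmSlice A t).card) (hA.image _)
  have hpos := (bmSlice_nonempty A t ht).card_pos
  obtain ⟨u, hu, hun⟩ := bm_root n ((bmSlice A t).card : ℝ) (by exact_mod_cast hpos) (by
    rintro rfl
    have := Finset.card_le_univ (bmSlice A t)
    simp at this
    have : (bmSlice A t).card = 1 := by omega
    exact_mod_cast this)
  refine ⟨u, hu, fun s hs => ?_, t, ht, hun.symm⟩
  rw [hun]
  exact_mod_cast hmax s hs

/-- Discrete Brunn-Minkowski inequality. -/
theorem bm_discrete (n : ℕ) : ∀ A B C : Finset (Fin n → ℤ), A.Nonempty → B.Nonempty →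
    (∀ x ∈ A, ∀ y ∈ B, ∀ e : Fin n → ℤ, (∀ i, e i = 0 ∨ e i = 1) → x + y + e ∈ C) →
    ∀ a b : ℝ, 0 ≤ a → 0 ≤ b → a ^ n ≤ A.card → b ^ n ≤ B.card → (a + b) ^ n ≤ C.card := by
  induction n with
  | zero =>
    intro A B C hA hB h a b _ _ _ _
    obtain ⟨x, hx⟩ := hA
    obtain ⟨y, hy⟩ := hB
    have : 0 < C.card := Finset.card_pos.2 ⟨_, h x hx y hy 0 (by simp)⟩
    simp only [pow_zero]
    exact_mod_cast this
  | succ n ih =>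
    intro A B C hA hB h a b ha hb hcA hcB
    obtain ⟨u, hu, huM, s0, hs0, hs0u⟩ := bm_max A hA
    obtain ⟨v, hv, hvM, t0, ht0, ht0v⟩ := bm_max B hB
    have hun : 0 < u ^ n := by positivity
    have hvn : 0 < v ^ n := by positivity
    have huv : 0 < (u + v) ^ n := by positivity
    have key := bm_sum_le (A.image (fun x => x 0)) (B.image (fun x => x 0))
      (C.image (fun x => x 0))
      (fun t => ((bmSlice A t).card : ℝ) / u ^ n) (fun t => ((bmSlice B t).card : ℝ) / v ^ n)
      (fun t => ((bmSlice C t).card : ℝ) / (u + v) ^ n)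
      (fun t _ => by positivity) (fun t _ => by positivity) (fun t _ => by positivity)
      (fun t ht => by rw [div_le_one hun]; exact huM t ht)
      (fun t ht => by rw [div_le_one hvn]; exact hvM t ht)
      (by
        intro l hl hl1
        apply bm_one_dim
        · refine ⟨s0, Finset.mem_filter.2 ⟨hs0, ?_⟩⟩
          rw [hs0u, div_self hun.ne']
          exact hl1
        · refine ⟨t0, Finset.mem_filter.2 ⟨ht0, ?_⟩⟩
          rw [ht0v, div_self hvn.ne']
          exact hl1
        · intro s hs t ht e he
          rw [Finset.mem_filter] at hs ht ⊢
          obtain ⟨hs, hsl⟩ := hs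
          obtain ⟨ht, htl⟩ := ht
          rw [le_div_iff₀ hun] at hsl
          rw [le_div_iff₀ hvn] at htl
          have hAs := bmSlice_nonempty A s hs
          have hBt := bmSlice_nonempty B t ht
          have hsum : ∀ x ∈ bmSlice A s, ∀ y ∈ bmSlice B t, ∀ d : Fin n → ℤ,
              (∀ i, d i = 0 ∨ d i = 1) → x + y + d ∈ bmSlice C (s + t + e) := by
            intro x hx y hy d hd
            rw [mem_bmSlice] at hx hy ⊢
            have := h _ hx _ hy (Fin.cons e d) (by
              intro i
              refine Fin.cases ?_ (fun j => ?_) i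
              · simpa using he
              · simpa using hd j)
            convert this using 1
            funext i
            refine Fin.cases ?_ (fun j => ?_) i <;> simp
          constructor
          · obtain ⟨x, hx⟩ := hAs
            obtain ⟨y, hy⟩ := hBt
            have := hsum x hx y hy 0 (by simp)
            rw [mem_bmSlice] at this
            exact Finset.mem_image.2 ⟨_, this, by simp⟩
          · rw [le_div_iff₀ huv]
            rcases Nat.eq_zero_or_pos n with rfl | hn
            · have := ih _ _ _ hAs hBt hsum 0 0 le_rfl le_rfl
                (by simpa using hAs) (by simpa using hBt)
              simp only [pow_zero, mul_one] at this ⊢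
              linarith
            · obtain ⟨k, hk, hkn⟩ := bm_root n l hl (by omega)
              have := ih _ _ _ hAs hBt hsum (k * u) (k * v) (by positivity) (by positivity)
                (by rw [mul_pow, hkn]; exact hsl) (by rw [mul_pow, hkn]; exact htl)
              rwa [← mul_add, mul_pow, hkn] at this)
    simp only [← Finset.sum_div] at key
    have eA : (∑ t ∈ A.image (fun x => x 0), ((bmSlice A t).card : ℝ)) = A.card := by
      rw [card_eq_sum_bmSlice A]; push_cast; rfl
    have eB : (∑ t ∈ B.image (fun x => x 0), ((bmSlice B t).card : ℝ)) = B.card := by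
      rw [card_eq_sum_bmSlice B]; push_cast; rfl
    have eC : (∑ t ∈ C.image (fun x => x 0), ((bmSlice C t).card : ℝ)) = C.card := by
      rw [card_eq_sum_bmSlice C]; push_cast; rfl
    rw [eA, eB, eC, le_div_iff₀ huv] at key
    calc (a + b) ^ (n+1) ≤ (u + v) ^ n * (a ^ (n+1) / u ^ n + b ^ (n+1) / v ^ n) :=
          bm_holder n a b u v ha hb hu hv
      _ ≤ (u + v) ^ n * (A.card / u ^ n + B.card / v ^ n) := by gcongr
      _ ≤ C.card := by rw [mul_comm]; exact key

/-- Dilate-and-fill: replaces each point by an `m`-cube of points. -/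
noncomputable def bmFill {n : ℕ} (m : ℕ) (A : Finset (Fin n → ℤ)) : Finset (Fin n → ℤ) :=
  (A ×ˢ Fintype.piFinset (fun _ : Fin n => Finset.Ico (0:ℤ) m)).image
    (fun x => fun i => (m:ℤ) * x.1 i + x.2 i)

theorem card_bmFill {n : ℕ} (m : ℕ) (A : Finset (Fin n → ℤ)) :
    (bmFill m A).card = A.card * m ^ n := by
  unfold bmFill
  rw [Finset.card_image_of_injOn]
  · simp
  · rintro ⟨x, r⟩ hx ⟨y, s⟩ hy hxy
    simp only [Finset.coe_product, Set.mem_prod, Finset.mem_coe, Fintype.mem_piFinset,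
      Finset.mem_Ico] at hx hy
    have key : ∀ i, x i = y i ∧ r i = s i := by
      intro i
      have h := congrFun hxy i
      simp only at h
      have h1 := hx.2 i
      have h2 := hy.2 i
      have hr := Int.emod_eq_of_lt h1.1 h1.2
      have hs := Int.emod_eq_of_lt h2.1 h2.2
      have h3 : r i = s i := by
        rw [← hr, ← hs, ← Int.mul_add_emod_self_left (m:ℤ) (x i) (r i), h,
          Int.mul_add_emod_self_left]
      refine ⟨?_, h3⟩
      rw [h3] at h
      have hm : (m:ℤ) ≠ 0 := by omega
      exact mul_left_cancel₀ hm (add_right_cancel h)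
    rw [Prod.mk.injEq]
    exact ⟨funext fun i => (key i).1, funext fun i => (key i).2⟩

theorem bm_lattice_finset (n : ℕ) (M : Set (Fin n → ℝ))
    (hM : (M ∩ {x : Fin n → ℝ | ∀ i, ∃ z : ℤ, x i = z}).Finite) :
    ∃ A : Finset (Fin n → ℤ), A.card = latticeEnum n M ∧
      ∀ x : Fin n → ℤ, x ∈ A ↔ (fun i => (x i : ℝ)) ∈ M := by
  have hinj : Function.Injective (fun (x : Fin n → ℤ) => (fun i => (x i : ℝ))) := by
    intro x y h
    funext i
    have : (x i : ℝ) = y i := congrFun h i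
    exact_mod_cast this
  set f : (Fin n → ℤ) → (Fin n → ℝ) := fun x i => (x i : ℝ) with hf
  have heq : f '' (f ⁻¹' M) = M ∩ {x : Fin n → ℝ | ∀ i, ∃ z : ℤ, x i = z} := by
    rw [Set.image_preimage_eq_inter_range]
    congr 1
    ext x
    constructor
    · rintro ⟨y, rfl⟩ i
      exact ⟨y i, rfl⟩
    · intro h
      choose z hz using h
      exact ⟨z, funext fun i => (hz i).symm⟩
  have hfin : (f ⁻¹' M).Finite := by
    rw [← heq] at hM
    exact hM.of_finite_image hinj.injOn
  refine ⟨hfin.toFinset, ?_, fun x => by simp [hf]⟩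
  unfold latticeEnum
  rw [← heq, Set.ncard_image_of_injective _ hinj, Set.ncard_eq_toFinset_card _ hfin]

theorem bm_bounded_finite (n : ℕ) (M : Set (Fin n → ℝ)) (hM : Bornology.IsBounded M) :
    (M ∩ {x : Fin n → ℝ | ∀ i, ∃ z : ℤ, x i = z}).Finite := by
  obtain ⟨R, hR⟩ := hM.exists_norm_le
  have : (Set.pi Set.univ (fun _ : Fin n => Set.Icc (-⌈R⌉) ⌈R⌉)).Finite :=
    Set.Finite.pi' (fun _ => Set.finite_Icc _ _) |>.subset (by intro x hx i; exact hx i trivial)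
  refine (this.image (fun x => fun i => (x i : ℝ))).subset ?_
  rintro x ⟨hx, hz⟩
  choose z hz using hz
  refine ⟨z, fun i _ => ?_, funext fun i => (hz i).symm⟩
  have h1 := (norm_le_pi_norm x i).trans (hR x hx)
  rw [Real.norm_eq_abs, hz i] at h1
  have h2 : ((|z i| : ℤ) : ℝ) ≤ (⌈R⌉ : ℤ) := by
    push_cast
    exact h1.trans (Int.le_ceil R)
  exact abs_le.1 (by exact_mod_cast h2)

theorem stmt12 (n : ℕ) (hn : 0 < n) (K L : Set (Fin n → ℝ))
    (hKb : Bornology.IsBounded K) (hLb : Bornology.IsBounded L)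
    (hKL : 0 < latticeEnum n K * latticeEnum n L)
    (m p q : ℕ) (hm : 0 < m) (hp : 0 < p) (hq : 0 < q)
    (hαβ : (m : ℝ) / q + (p : ℝ) / q ≤ 1) :
    (latticeEnum n (((m : ℝ) / q) • K + ((p : ℝ) / q) • L +
        {x : Fin n → ℝ | ∀ i, x i ∈ Set.Icc (-(((q : ℝ) - 1) / q)) (((q : ℝ) - 1) / q)})
        : ℝ) ^ ((1 : ℝ) / n) ≥
      (m : ℝ) / q * (latticeEnum n K : ℝ) ^ ((1 : ℝ) / n) +
        (p : ℝ) / q * (latticeEnum n L : ℝ) ^ ((1 : ℝ) / n) := by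
  have hn' : n ≠ 0 := hn.ne'
  have hK0 : 0 < latticeEnum n K := Nat.pos_of_mul_pos_right hKL
  have hL0 : 0 < latticeEnum n L := Nat.pos_of_mul_pos_left hKL
  have hqR : (0:ℝ) < q := by exact_mod_cast hq
  have hmpq : m + p ≤ q := by
    rw [← add_div, div_le_one hqR] at hαβ
    exact_mod_cast hαβ
  set Q : Set (Fin n → ℝ) :=
    {x : Fin n → ℝ | ∀ i, x i ∈ Set.Icc (-(((q : ℝ) - 1) / q)) (((q : ℝ) - 1) / q)} with hQ
  have hQb : Bornology.IsBounded Q := by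
    refine (Bornology.IsBounded.pi (S := fun _ : Fin n =>
      Set.Icc (-(((q : ℝ) - 1) / q)) (((q : ℝ) - 1) / q)) fun i => Metric.isBounded_Icc _ _).subset ?_
    intro x hx i _
    exact hx i
  have hSb : Bornology.IsBounded (((m : ℝ) / q) • K + ((p : ℝ) / q) • L + Q) :=
    ((hKb.smul₀ _).add (hLb.smul₀ _)).add hQb
  obtain ⟨A, hAc, hA⟩ := bm_lattice_finset n K (bm_bounded_finite n K hKb)
  obtain ⟨B, hBc, hB⟩ := bm_lattice_finset n L (bm_bounded_finite n L hLb)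
  obtain ⟨S, hSc, hS⟩ := bm_lattice_finset n _ (bm_bounded_finite n _ hSb)
  rw [← hSc, ← hAc, ← hBc]
  rw [← hAc] at hK0
  rw [← hBc] at hL0
  have hcS : (bmFill q S).card = S.card * q ^ n := card_bmFill q S
  have hcA : (bmFill m A).card = A.card * m ^ n := card_bmFill m A
  have hcB : (bmFill p B).card = B.card * p ^ n := card_bmFill p B
  have hpowA : ((A.card : ℝ) ^ ((1:ℝ)/n)) ^ n = A.card := by
    rw [one_div]; exact Real.rpow_inv_natCast_pow (by positivity) hn'
  have hpowB : ((B.card : ℝ) ^ ((1:ℝ)/n)) ^ n = B.card := by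
    rw [one_div]; exact Real.rpow_inv_natCast_pow (by positivity) hn'
  have hpowS : ((S.card : ℝ) ^ ((1:ℝ)/n)) ^ n = S.card := by
    rw [one_div]; exact Real.rpow_inv_natCast_pow (by positivity) hn'
  have key := bm_discrete n (bmFill m A) (bmFill p B) (bmFill q S)
    (by rw [← Finset.card_pos, hcA]; positivity)
    (by rw [← Finset.card_pos, hcB]; positivity)
    (by
      intro x hx y hy e he
      unfold bmFill at hx hy ⊢
      obtain ⟨⟨a, r⟩, har, rfl⟩ := Finset.mem_image.1 hx
      obtain ⟨⟨b, s⟩, hbs, rfl⟩ := Finset.mem_image.1 hy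
      simp only [Finset.mem_product, Fintype.mem_piFinset, Finset.mem_Ico] at har hbs
      obtain ⟨ha, hr⟩ := har
      obtain ⟨hb, hs⟩ := hbs
      rw [hA] at ha
      rw [hB] at hb
      set w : Fin n → ℤ := (fun i => (m:ℤ) * a i + r i) + (fun i => (p:ℤ) * b i + s i) + e with hw
      have hqZ : (0:ℤ) < q := by exact_mod_cast hq
      refine Finset.mem_image.2 ⟨⟨fun i => w i / q, fun i => w i % q⟩, ?_, ?_⟩
      · simp only [Finset.mem_product, Fintype.mem_piFinset, Finset.mem_Ico]
        refine ⟨?_, fun i => ⟨Int.emod_nonneg _ hqZ.ne', Int.emod_lt_of_pos _ hqZ⟩⟩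
        rw [hS]
        refine Set.mem_add.2 ⟨_, Set.add_mem_add (Set.smul_mem_smul_set ha)
          (Set.smul_mem_smul_set hb),
          fun i => ((r i + s i + e i - w i % q : ℤ) : ℝ) / q, ?_, ?_⟩
        · intro i
          have h1 := Int.emod_nonneg (w i) hqZ.ne'
          have h2 := Int.emod_lt_of_pos (w i) hqZ
          have h3 := hr i
          have h4 := hs i
          have h5 := he i
          have h6 : -((q:ℤ) - 1) ≤ r i + s i + e i - w i % q := by omega
          have h7 : r i + s i + e i - w i % q ≤ (q:ℤ) - 1 := by omega
          have h6' : -((q:ℝ) - 1) ≤ ((r i + s i + e i - w i % q : ℤ) : ℝ) := by exact_mod_cast h6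
          have h7' : ((r i + s i + e i - w i % q : ℤ) : ℝ) ≤ (q:ℝ) - 1 := by exact_mod_cast h7
          constructor
          · rw [← neg_div]; exact div_le_div_of_nonneg_right h6' hqR.le
          · exact div_le_div_of_nonneg_right h7' hqR.le
        · funext i
          have h1 : (q:ℤ) * (w i / q) + w i % q = w i := Int.mul_ediv_add_emod _ _
          have h2 : w i = (m:ℤ) * a i + r i + (p * b i + s i) + e i := by simp [hw]
          have h3 : (m:ℤ) * a i + p * b i + (r i + s i + e i - w i % q) = q * (w i / q) := by
            linarith
          have h4 : (m:ℝ) * a i + p * b i + ((r i + s i + e i - w i % q : ℤ) : ℝ)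
              = q * ((w i / q : ℤ) : ℝ) := by exact_mod_cast h3
          simp only [Pi.add_apply, Pi.smul_apply, smul_eq_mul]
          rw [← mul_right_inj' hqR.ne', ← h4]
          field_simp
      · funext i
        exact Int.mul_ediv_add_emod _ _)
    (m * (A.card : ℝ) ^ ((1:ℝ)/n)) (p * (B.card : ℝ) ^ ((1:ℝ)/n)) (by positivity) (by positivity)
    (by rw [mul_pow, hpowA, hcA]; push_cast; rw [mul_comm])
    (by rw [mul_pow, hpowB, hcB]; push_cast; rw [mul_comm])
  have e2 : ((bmFill q S).card : ℝ) = (q * (S.card : ℝ) ^ ((1:ℝ)/n)) ^ n := by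
    rw [mul_pow, hpowS, hcS]; push_cast; rw [mul_comm]
  rw [e2] at key
  have fin := le_of_pow_le_pow_left₀ hn' (by positivity) key
  rw [ge_iff_le, ← mul_le_mul_iff_right₀ hqR]
  refine le_trans (le_of_eq ?_) fin
  field_simp
end

section
/- Let K, L ⊂ ℝⁿ be bounded sets with G_n(K)·G_n(L) > 0. Then G_n((K + L)/2 + [0,1]ⁿ)^{1/n} ≥ (G_n(K)^{1/n} + G_n(L)^{1/n})/2. -/
open Set
open scoped Pointwise

/-- One-dimensional sumset estimate. -/
lemma sumset_one (s t U : Finset ℤ) (hs : s.Nonempty) (ht : t.Nonempty)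
    (h : ∀ i ∈ s, ∀ j ∈ t, i + j ∈ U ∧ i + j + 1 ∈ U) : s.card + t.card ≤ U.card := by
  classical
  have h1 : (s.image (fun i => i + t.min' ht)).card = s.card :=
    Finset.card_image_of_injective _ (fun a b hab => by simpa using hab)
  have h2 : (t.image (fun j => s.max' hs + j + 1)).card = t.card :=
    Finset.card_image_of_injective _ (fun a b hab => by simpa using hab)
  have hd : Disjoint (s.image (fun i => i + t.min' ht)) (t.image (fun j => s.max' hs + j + 1)) := by
    rw [Finset.disjoint_left]
    intro x hx hy
    simp only [Finset.mem_image] at hx hy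
    obtain ⟨i, hi, rfl⟩ := hx
    obtain ⟨j, hj, hh⟩ := hy
    have := s.le_max' i hi
    have := t.min'_le j hj
    omega
  rw [← h1, ← h2, ← Finset.card_union_of_disjoint hd]
  apply Finset.card_le_card
  intro x hx
  simp only [Finset.mem_union, Finset.mem_image] at hx
  rcases hx with ⟨i, hi, rfl⟩ | ⟨j, hj, rfl⟩
  · exact (h i hi _ (t.min'_mem ht)).1
  · exact (h _ (s.max'_mem hs) j hj).2

lemma layer_integrable (c : ℝ) : MeasureTheory.IntegrableOn
    ((Set.Iic c).indicator (fun _ => (1 : ℝ))) (Set.Ioc 0 1) := by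
  apply MeasureTheory.Integrable.indicator _ measurableSet_Iic
  exact MeasureTheory.integrable_const _

lemma layer_integral (c : ℝ) (hc : 0 ≤ c) :
    ∫ u in Set.Ioc (0 : ℝ) 1, (Set.Iic c).indicator (fun _ => (1 : ℝ)) u = min c 1 := by
  rw [MeasureTheory.integral_indicator measurableSet_Iic]
  rw [MeasureTheory.Measure.restrict_restrict measurableSet_Iic]
  have : Set.Iic c ∩ Set.Ioc (0 : ℝ) 1 = Set.Ioc 0 (min c 1) := by
    ext u
    simp only [Set.mem_inter_iff, Set.mem_Iic, Set.mem_Ioc, le_min_iff]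
    tauto
  rw [this]
  have h0 : 0 ≤ min c 1 := le_min hc zero_le_one
  simp [h0]

lemma layer_sum (I : Finset ℤ) (f : ℤ → ℝ) (hf : ∀ i, 0 ≤ f i) :
    ∫ u in Set.Ioc (0 : ℝ) 1, ((I.filter (fun i => u ≤ f i)).card : ℝ)
      = ∑ i ∈ I, min (f i) 1 := by
  have : ∀ u : ℝ, ((I.filter (fun i => u ≤ f i)).card : ℝ)
      = ∑ i ∈ I, (Set.Iic (f i)).indicator (fun _ => (1 : ℝ)) u := by
    intro u
    rw [Finset.card_filter]
    simp only [Set.indicator_apply, Set.mem_Iic]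
    push_cast
    rfl
  simp_rw [this]
  rw [MeasureTheory.integral_finsetSum _ (fun i _ => layer_integrable (f i))]
  exact Finset.sum_congr rfl (fun i _ => layer_integral _ (hf i))

lemma layer_sum_int (I : Finset ℤ) (f : ℤ → ℝ) :
    MeasureTheory.IntegrableOn (fun u : ℝ => ((I.filter (fun i => u ≤ f i)).card : ℝ))
      (Set.Ioc 0 1) := by
  have : (fun u : ℝ => ((I.filter (fun i => u ≤ f i)).card : ℝ))
      = fun u => ∑ i ∈ I, (Set.Iic (f i)).indicator (fun _ => (1 : ℝ)) u := by
    funext u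
    rw [Finset.card_filter]
    simp only [Set.indicator_apply, Set.mem_Iic]
    push_cast
    rfl
  rw [this]
  exact MeasureTheory.integrable_finsetSum _ (fun i _ => layer_integrable (f i))

/-- One-dimensional functional inequality (normalised). -/
lemma func_one (I J T : Finset ℤ) (f g h : ℤ → ℝ)
    (hf : ∀ i, 0 ≤ f i) (hg : ∀ i, 0 ≤ g i) (hh : ∀ i, 0 ≤ h i)
    (hf1 : ∀ i ∈ I, f i ≤ 1) (hg1 : ∀ i ∈ J, g i ≤ 1)
    (hi : ∃ i ∈ I, f i = 1) (hj : ∃ j ∈ J, g j = 1)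
    (H : ∀ u : ℝ, 0 < u → u ≤ 1 → ∀ i ∈ I, ∀ j ∈ J, u ≤ f i → u ≤ g j →
      (i + j ∈ T ∧ u ≤ h (i + j)) ∧ (i + j + 1 ∈ T ∧ u ≤ h (i + j + 1))) :
    ∑ i ∈ I, f i + ∑ j ∈ J, g j ≤ ∑ k ∈ T, h k := by
  have e1 : ∑ i ∈ I, f i = ∑ i ∈ I, min (f i) 1 :=
    Finset.sum_congr rfl (fun i hi => (min_eq_left (hf1 i hi)).symm)
  have e2 : ∑ i ∈ J, g i = ∑ i ∈ J, min (g i) 1 :=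
    Finset.sum_congr rfl (fun i hi => (min_eq_left (hg1 i hi)).symm)
  have e3 : ∑ k ∈ T, min (h k) 1 ≤ ∑ k ∈ T, h k :=
    Finset.sum_le_sum (fun i _ => min_le_left _ _)
  refine le_trans ?_ e3
  rw [e1, e2, ← layer_sum I f hf, ← layer_sum J g hg, ← layer_sum T h hh,
    ← MeasureTheory.integral_add (layer_sum_int I f) (layer_sum_int J g)]
  apply MeasureTheory.setIntegral_mono_on ((layer_sum_int I f).add (layer_sum_int J g))
    (layer_sum_int T h) measurableSet_Ioc
  intro u hu
  obtain ⟨i, hiI, hi⟩ := hi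
  obtain ⟨j, hjJ, hj⟩ := hj
  have := sumset_one (I.filter (fun i => u ≤ f i)) (J.filter (fun i => u ≤ g i))
    (T.filter (fun i => u ≤ h i)) ⟨i, by simp [hiI, hi, hu.2]⟩ ⟨j, by simp [hjJ, hj, hu.2]⟩
    (by
      intro i hi j hj
      simp only [Finset.mem_filter] at hi hj ⊢
      exact H u hu.1 hu.2 i hi.1 j hj.1 hi.2 hj.2)
  simp only [Pi.add_apply]
  exact_mod_cast this

lemma holder_pow (m : ℕ) (x y a b : ℝ) (hx : 0 ≤ x) (hy : 0 ≤ y) (ha : 0 < a) (hb : 0 < b) :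
    (x + y) ^ (m + 1) ≤ (a + b) ^ m * (x ^ (m + 1) / a ^ m + y ^ (m + 1) / b ^ m) := by
  have hab : 0 < a + b := by positivity
  have hc := (convexOn_pow (𝕜 := ℝ) (m + 1)).2
    (show x / a ∈ Set.Ici 0 from div_nonneg hx ha.le)
    (show y / b ∈ Set.Ici 0 from div_nonneg hy hb.le)
    (show 0 ≤ a / (a + b) by positivity) (show 0 ≤ b / (a + b) by positivity) (by field_simp)
  simp only [smul_eq_mul] at hc
  have e1 : a / (a + b) * (x / a) + b / (a + b) * (y / b) = (x + y) / (a + b) := by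
    field_simp
  rw [e1, div_pow, div_le_iff₀ (by positivity)] at hc
  refine hc.trans (le_of_eq ?_)
  rw [div_pow, div_pow]
  field_simp
  ring

/-- The slice of `A` at first coordinate `i`. -/
noncomputable def zslice {m : ℕ} (A : Finset (Fin (m + 1) → ℤ)) (i : ℤ) : Finset (Fin m → ℤ) :=
  (A.filter (fun v => v 0 = i)).image Fin.tail

lemma mem_zslice {m : ℕ} (A : Finset (Fin (m + 1) → ℤ)) (i : ℤ) (v : Fin m → ℤ) :
    v ∈ zslice A i ↔ (Fin.cons i v : Fin (m + 1) → ℤ) ∈ A := by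
  simp only [zslice, Finset.mem_image, Finset.mem_filter]
  constructor
  · rintro ⟨w, ⟨hw, rfl⟩, rfl⟩
    rwa [Fin.cons_self_tail]
  · intro h
    exact ⟨_, ⟨h, by simp⟩, by simp⟩

lemma card_zslice {m : ℕ} (A : Finset (Fin (m + 1) → ℤ)) :
    (A.card : ℝ) = ∑ i ∈ A.image (fun v => v 0), ((zslice A i).card : ℝ) := by
  rw [Finset.card_eq_sum_card_image (fun v : Fin (m + 1) → ℤ => v 0) A]
  push_cast
  apply Finset.sum_congr rfl
  intro i _
  rw [zslice, Finset.card_image_of_injOn]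
  intro v hv w hw h
  simp only [Finset.coe_filter, Set.mem_ofPred_eq] at hv hw
  rw [← Fin.cons_self_tail v, ← Fin.cons_self_tail w, hv.2, hw.2, h]

lemma exists_max_slice {m : ℕ} (A : Finset (Fin (m + 1) → ℤ)) (hA : A.Nonempty) :
    ∃ i ∈ A.image (fun v => v 0), 0 < (zslice A i).card ∧
      ∀ j ∈ A.image (fun v => v 0), (zslice A j).card ≤ (zslice A i).card := by
  obtain ⟨i, hi, h⟩ := Finset.exists_max_image (A.image (fun v => v 0))
    (fun i => (zslice A i).card) (hA.image _)
  refine ⟨i, hi, ?_, h⟩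
  obtain ⟨v, hv, rfl⟩ := Finset.mem_image.1 hi
  exact Finset.card_pos.2 ⟨Fin.tail v, (mem_zslice _ _ _).2 (by rwa [Fin.cons_self_tail])⟩

lemma exists_root (m c : ℕ) (hc : 0 < c) (hm : m = 0 → c = 1) : ∃ a : ℝ, 0 < a ∧ a ^ m = c := by
  rcases Nat.eq_zero_or_pos m with h | h
  · exact ⟨1, one_pos, by simp [hm h]⟩
  · refine ⟨(c : ℝ) ^ ((m : ℝ)⁻¹), by positivity, ?_⟩
    exact Real.rpow_inv_natCast_pow (by positivity) h.ne'

lemma card_zero_dim {m : ℕ} (hm : m = 0) (A : Finset (Fin m → ℤ)) (h : 0 < A.card) :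
    A.card = 1 := by
  subst hm
  have : A.card ≤ 1 := Finset.card_le_one_of_subsingleton A
  omega

/-- Discrete Brunn--Minkowski inequality for `A + B + {0,1}^n`. -/
lemma discrete_BM (n : ℕ) : ∀ (A B S : Finset (Fin n → ℤ)), A.Nonempty → B.Nonempty →
    (∀ a ∈ A, ∀ b ∈ B, ∀ e : Fin n → ℤ, (∀ i, e i = 0 ∨ e i = 1) → a + b + e ∈ S) →
    ∀ x y : ℝ, 0 ≤ x → 0 ≤ y → x ^ n ≤ A.card → y ^ n ≤ B.card → (x + y) ^ n ≤ S.card := by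
  induction n with
  | zero =>
    intro A B S ⟨a, ha⟩ ⟨b, hb⟩ H x y _ _ _ _
    have : 0 < S.card := Finset.card_pos.2 ⟨_, H a ha b hb 0 (by simp)⟩
    simp only [pow_zero]
    exact_mod_cast this
  | succ m ih =>
    intro A B S hA hB H x y hx hy hxA hyB
    obtain ⟨i0, hi0, hα, hmaxA⟩ := exists_max_slice A hA
    obtain ⟨j0, hj0, hβ, hmaxB⟩ := exists_max_slice B hB
    obtain ⟨a, ha, haα⟩ := exists_root m _ hα (fun hm => card_zero_dim hm _ hα)
    obtain ⟨b, hb, hbβ⟩ := exists_root m _ hβ (fun hm => card_zero_dim hm _ hβ)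
    have ham : 0 < a ^ m := by positivity
    have hbm : 0 < b ^ m := by positivity
    have hγ : 0 < (a + b) ^ m := by positivity
    have key := func_one (A.image (fun v => v 0)) (B.image (fun v => v 0))
      (S.image (fun v => v 0))
      (fun i => (zslice A i).card / a ^ m) (fun i => (zslice B i).card / b ^ m)
      (fun i => (zslice S i).card / (a + b) ^ m)
      (fun i => by positivity) (fun i => by positivity) (fun i => by positivity)
      (fun i hi => by
        rw [div_le_one ham, haα]; exact_mod_cast hmaxA i hi)
      (fun i hi => by
        rw [div_le_one hbm, hbβ]; exact_mod_cast hmaxB i hi)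
      ⟨i0, hi0, by rw [haα]; exact div_self (by positivity)⟩
      ⟨j0, hj0, by rw [hbβ]; exact div_self (by positivity)⟩
      (by
        intro u hu hu1 i hi j hj hui huj
        rw [le_div_iff₀ ham] at hui
        rw [le_div_iff₀ hbm] at huj
        have hAi : 0 < (zslice A i).card := by
          have : (0 : ℝ) < (zslice A i).card := lt_of_lt_of_le (by positivity) hui
          exact_mod_cast this
        have hBj : 0 < (zslice B j).card := by
          have : (0 : ℝ) < (zslice B j).card := lt_of_lt_of_le (by positivity) huj
          exact_mod_cast this
        have main : ∀ d : ℤ, (d = 0 ∨ d = 1) →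
            u ≤ (zslice S (i + j + d)).card / (a + b) ^ m := by
          intro d hd
          rw [le_div_iff₀ hγ]
          have step := ih (zslice A i) (zslice B j) (zslice S (i + j + d))
            (Finset.card_pos.1 hAi) (Finset.card_pos.1 hBj) (by
              intro v hv w hw e he
              rw [mem_zslice] at hv hw ⊢
              have := H _ hv _ hw (Fin.cons d e) (by
                intro k
                refine Fin.cases ?_ ?_ k
                · simpa using hd
                · intro k; simpa using he k)
              convert this using 1
              funext k
              refine Fin.cases ?_ ?_ k <;> simp)
          rcases Nat.eq_zero_or_pos m with hm | hm
          · have := step 0 0 le_rfl le_rfl 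
              (by subst hm; rw [pow_zero]; exact_mod_cast hAi)
              (by subst hm; rw [pow_zero]; exact_mod_cast hBj)
            subst hm
            simp only [pow_zero] at this ⊢
            linarith
          · have hv : (u ^ ((m : ℝ)⁻¹)) ^ m = u := Real.rpow_inv_natCast_pow hu.le hm.ne'
            have hv0 : 0 ≤ u ^ ((m : ℝ)⁻¹) := by positivity
            have := step (u ^ ((m : ℝ)⁻¹) * a) (u ^ ((m : ℝ)⁻¹) * b) (by positivity)
              (by positivity) (by rwa [mul_pow, hv]) (by rwa [mul_pow, hv])
            rwa [← mul_add, mul_pow, hv] at this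
        have mem : ∀ d : ℤ, (d = 0 ∨ d = 1) → i + j + d ∈ S.image (fun v => v 0) := by
          intro d hd
          have h1 := main d hd
          have h2 : (0 : ℝ) < (zslice S (i + j + d)).card := by
            rw [le_div_iff₀ hγ] at h1
            exact lt_of_lt_of_le (by positivity) h1
          have h3 : 0 < (zslice S (i + j + d)).card := by exact_mod_cast h2
          obtain ⟨v, hv⟩ := Finset.card_pos.1 h3
          rw [mem_zslice] at hv
          exact Finset.mem_image.2 ⟨_, hv, by simp⟩
        refine ⟨⟨?_, ?_⟩, mem 1 (Or.inr rfl), main 1 (Or.inr rfl)⟩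
        · simpa using mem 0 (Or.inl rfl)
        · simpa using main 0 (Or.inl rfl))
    rw [← Finset.sum_div, ← Finset.sum_div, ← Finset.sum_div, ← card_zslice, ← card_zslice,
      ← card_zslice, le_div_iff₀ hγ] at key
    calc (x + y) ^ (m + 1)
        ≤ (a + b) ^ m * (x ^ (m + 1) / a ^ m + y ^ (m + 1) / b ^ m) :=
          holder_pow m x y a b hx hy ha hb
      _ ≤ (a + b) ^ m * (A.card / a ^ m + B.card / b ^ m) := by gcongr
      _ ≤ S.card := by rw [mul_comm]; exact key

/-- Integer points, as integer vectors. -/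
def zpts (n : ℕ) (M : Set (Fin n → ℝ)) : Set (Fin n → ℤ) :=
  {z | (fun i => (z i : ℝ)) ∈ M}

lemma latticeEnum_eq (n : ℕ) (M : Set (Fin n → ℝ)) : latticeEnum n M = (zpts n M).ncard := by
  have hinj : Function.Injective (fun (z : Fin n → ℤ) (i : Fin n) => (z i : ℝ)) := by
    intro z w h
    funext i
    have := congrFun h i
    simpa using this
  rw [latticeEnum, ← Set.ncard_image_of_injective (zpts n M) hinj]
  congr 1
  ext x
  constructor
  · rintro ⟨hx, hz⟩
    choose z hz using hz
    have : x = fun i => (z i : ℝ) := funext hz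
    exact ⟨z, by simpa [zpts, ← this] using hx, this.symm⟩
  · rintro ⟨z, hz, rfl⟩
    exact ⟨hz, fun i => ⟨z i, rfl⟩⟩

lemma zpts_finite (n : ℕ) (M : Set (Fin n → ℝ)) (hM : Bornology.IsBounded M) :
    (zpts n M).Finite := by
  obtain ⟨R, hR⟩ := hM.subset_closedBall 0
  apply (Set.finite_Icc (fun _ : Fin n => -⌈R⌉) (fun _ => ⌈R⌉)).subset
  intro z hz
  have h1 := hR hz
  rw [mem_closedBall_zero_iff] at h1
  have h2 : ∀ i, |(z i : ℝ)| ≤ ⌈R⌉ := fun i =>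
    ((norm_le_pi_norm (fun i => (z i : ℝ)) i).trans h1).trans (Int.le_ceil R)
  constructor
  · intro i
    have := (abs_le.1 (h2 i)).1
    exact_mod_cast this
  · intro i
    have := (abs_le.1 (h2 i)).2
    exact_mod_cast this

theorem stmt17 (n : ℕ) (hn : 0 < n) (K L : Set (Fin n → ℝ))
    (hKb : Bornology.IsBounded K) (hLb : Bornology.IsBounded L)
    (hKL : 0 < latticeEnum n K * latticeEnum n L) :
    (latticeEnum n ((2 : ℝ)⁻¹ • (K + L) +
        {x : Fin n → ℝ | ∀ i, x i ∈ Set.Icc (0 : ℝ) 1}) : ℝ) ^ ((1 : ℝ) / n) ≥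
      ((latticeEnum n K : ℝ) ^ ((1 : ℝ) / n) + (latticeEnum n L : ℝ) ^ ((1 : ℝ) / n)) / 2 := by
  classical
  have hcube : Bornology.IsBounded {x : Fin n → ℝ | ∀ i, x i ∈ Set.Icc (0 : ℝ) 1} := by
    apply (Metric.isBounded_Icc (0 : Fin n → ℝ) 1).subset
    intro x hx
    exact ⟨fun i => (hx i).1, fun i => (hx i).2⟩
  have hNb : Bornology.IsBounded ((2 : ℝ)⁻¹ • (K + L) +
      {x : Fin n → ℝ | ∀ i, x i ∈ Set.Icc (0 : ℝ) 1}) := ((hKb.add hLb).smul₀ _).add hcube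
  have memN : ∀ z a b : Fin n → ℤ, a ∈ zpts n K → b ∈ zpts n L →
      (∀ i, 0 ≤ 2 * z i - a i - b i ∧ 2 * z i - a i - b i ≤ 2) →
      z ∈ zpts n ((2 : ℝ)⁻¹ • (K + L) +
        {x : Fin n → ℝ | ∀ i, x i ∈ Set.Icc (0 : ℝ) 1}) := by
    intro z a b ha hb h
    refine Set.mem_add.2 ⟨_, Set.smul_mem_smul_set (Set.add_mem_add ha hb),
      fun i => ((z i : ℝ) - 2⁻¹ * (a i + b i)), ?_, ?_⟩
    · intro i
      have h1 : (0 : ℝ) ≤ 2 * z i - a i - b i := by exact_mod_cast (h i).1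
      have h2 : (2 : ℝ) * z i - a i - b i ≤ 2 := by exact_mod_cast (h i).2
      constructor <;> linarith
    · funext i
      simp
      ring
  generalize ((2 : ℝ)⁻¹ • (K + L) + {x : Fin n → ℝ | ∀ i, x i ∈ Set.Icc (0 : ℝ) 1}) = N
    at hNb memN ⊢
  rw [latticeEnum_eq, latticeEnum_eq] at hKL
  rw [latticeEnum_eq, latticeEnum_eq, latticeEnum_eq]
  obtain ⟨A, hA⟩ := (zpts_finite n K hKb).exists_finset_coe
  obtain ⟨B, hB⟩ := (zpts_finite n L hLb).exists_finset_coe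
  obtain ⟨M, hM⟩ := (zpts_finite n N hNb).exists_finset_coe
  rw [← hA, ← hB, Set.ncard_coe_finset, Set.ncard_coe_finset] at hKL
  rw [← hA, ← hB, ← hM, Set.ncard_coe_finset, Set.ncard_coe_finset, Set.ncard_coe_finset]
  rw [← hA, ← hB, ← hM] at memN
  simp only [Finset.mem_coe] at memN
  set Q : Finset (Fin n → ℤ) := Fintype.piFinset (fun _ => ({0, 1} : Finset ℤ)) with hQ
  have hQc : Q.card = 2 ^ n := by simp [hQ]
  have hS : (A + B + Q).card ≤ (M ×ˢ Q).card := by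
    apply Finset.card_le_card_of_injOn
      (fun s => ((fun i => (s i + 1) / 2, fun i => s i % 2) : (Fin n → ℤ) × (Fin n → ℤ)))
    · intro s hs
      obtain ⟨c, hc, e, he, rfl⟩ := Finset.mem_add.1 (Finset.mem_coe.1 hs)
      obtain ⟨a, ha, b, hb, rfl⟩ := Finset.mem_add.1 hc
      simp only [hQ, Fintype.mem_piFinset, Finset.mem_insert, Finset.mem_singleton] at he
      simp only [Finset.mem_coe, Finset.mem_product]
      constructor
      · apply memN _ a b ha hb
        intro i
        have := he i
        simp only [Pi.add_apply]
        omega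
      · simp only [hQ, Fintype.mem_piFinset, Finset.mem_insert, Finset.mem_singleton]
        intro i
        omega
    · intro s _ t _ h
      simp only [Prod.mk.injEq] at h
      funext i
      have h1 := congrFun h.1 i
      have h2 := congrFun h.2 i
      omega
  rw [Finset.card_product, hQc] at hS
  have hApos : 0 < A.card := Nat.pos_of_mul_pos_right hKL
  have hBpos : 0 < B.card := Nat.pos_of_mul_pos_left hKL
  rw [one_div]
  have hx : ((A.card : ℝ) ^ ((n : ℝ)⁻¹)) ^ n = A.card :=
    Real.rpow_inv_natCast_pow (by positivity) hn.ne'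
  have hy : ((B.card : ℝ) ^ ((n : ℝ)⁻¹)) ^ n = B.card :=
    Real.rpow_inv_natCast_pow (by positivity) hn.ne'
  have hz : ((M.card : ℝ) ^ ((n : ℝ)⁻¹)) ^ n = M.card :=
    Real.rpow_inv_natCast_pow (by positivity) hn.ne'
  have bm := discrete_BM n A B (A + B + Q) (Finset.card_pos.1 hApos) (Finset.card_pos.1 hBpos)
    (by
      intro a ha b hb e he
      refine Finset.add_mem_add (Finset.add_mem_add ha hb) ?_
      simpa [hQ, Fintype.mem_piFinset] using he)
    _ _ (by positivity) (by positivity) hx.le hy.le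
  have hS' : ((A + B + Q).card : ℝ) ≤ M.card * 2 ^ n := by exact_mod_cast hS
  apply le_of_pow_le_pow_left₀ hn.ne' (by positivity)
  rw [hz, div_pow, div_le_iff₀ (by positivity)]
  exact bm.trans hS'
end
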